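/- Let D ∈ (-1/2,0) and define w*(D) = (-D + sqrt(-D(1+D)))/(D(1+2D)), the negative root of 1 + 2Dw + D(1+2D)w^2 = 0. Then the quartic P(x;D) = -1 - 4Dx - 2D(2D-1)x^2 - 2D(1+D+2D^2)x^3 + D^2(1+2D)x^4 satisfies P(w*(D);D) = -(2(D+1)(4D^2+4D-1) w*(D) + 2(2D+3)(D+1))/(1+2D)^2, and this value is strictly negative. -/

import Mathlib

/-- For `D ∈ (-1/2,0)` and `w* = (-D + √(-D(1+D)))/(D(1+2D))` the negative
root of `1+2Dw+D(1+2D)w² = 0`, the quartic `P(·;D)` satisfies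
`P(w*;D) = -(2(D+1)(4D²+4D-1)w* + 2(2D+3)(D+1))/(1+2D)²`, which is
strictly negative. -/
theorem stmt_3 :
    ∀ D : ℝ, -1/2 < D → D < 0 →
      ∀ w : ℝ, w = (-D + Real.sqrt (-D*(1+D))) / (D*(1+2*D)) →
        (-1 - 4*D*w - 2*D*(2*D-1)*w^2 - 2*D*(1+D+2*D^2)*w^3
            + D^2*(1+2*D)*w^4
          = -(2*(D+1)*(4*D^2+4*D-1)*w + 2*(2*D+3)*(D+1)) / (1+2*D)^2) ∧
        -(2*(D+1)*(4*D^2+4*D-1)*w + 2*(2*D+3)*(D+1)) / (1+2*D)^2 < 0 := by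
  intro D h1 h2 w hw
  have hE : 0 < 1 + 2*D := by linarith
  have hDE : D*(1+2*D) < 0 := mul_neg_of_neg_of_pos h2 hE
  have hpos : 0 ≤ -D*(1+D) := mul_nonneg (by linarith) (by linarith)
  have hs := Real.sq_sqrt hpos
  have hs0 := Real.sqrt_nonneg (-D*(1+D))
  have hwneg : w < 0 := by
    rw [hw]
    exact div_neg_of_pos_of_neg (by linarith) hDE
  have hlin : D*(1+2*D)*w + D = Real.sqrt (-D*(1+D)) := by
    rw [hw, mul_div_cancel₀ _ hDE.ne]
    ring
  have hq : 1 + 2*D*w + D*(1+2*D)*w^2 = 0 := by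
    rw [← hlin] at hs
    have h3 : D*(1+2*D) * (1 + 2*D*w + D*(1+2*D)*w^2) = 0 := by
      linear_combination hs
    exact (mul_eq_zero.mp h3).resolve_left hDE.ne
  constructor
  · rw [eq_div_iff (pow_ne_zero 2 hE.ne')]
    linear_combination (D*(1+2*D)^2*w^2 - 2*(1+2*D)*(1+2*D+2*D^2)*w + 5 + 6*D) * hq
  · apply div_neg_of_neg_of_pos _ (pow_pos hE 2)
    have h4 : 4*D^2+4*D-1 < 0 := by nlinarith
    have h5 : 0 < (D+1) * ((4*D^2+4*D-1)*w) :=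
      mul_pos (by linarith) (mul_pos_of_neg_of_neg h4 hwneg)
    have h6 : 0 < (2*D+3)*(D+1) := mul_pos (by linarith) (by linarith)
    linarith
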